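/- arXiv:2411.13858 — 2 statements merged into one kernel-verified Lean document; each statement's English description precedes it below -/
import Mathlib

section
/- Let β ∈ Σ and γ ∈ Σ ∪ {0} be such that ⟨β, β + 2γ⟩ ≥ 0. Then for every nonzero x ∈ 𝔤_β one has [x, 𝔤_γ] = 𝔤_{β+γ} (where 𝔤_{β+γ} = {0} if β + γ ∉ Σ ∪ {0}). -/
variable {𝔤 : Type*} [LieRing 𝔤] [LieAlgebra ℝ 𝔤]

/-- The restricted root space `𝔤_β = {x ∈ 𝔤 | [a, x] = β(a) • x for all a ∈ 𝔞}` of a linear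
functional `β` on a subalgebra `𝔞`.  (For `β = 0` this is the centralizer `𝔤₀` of `𝔞`.) -/
def restrictedRootSpace (𝔞 : LieSubalgebra ℝ 𝔤) (β : Module.Dual ℝ ↥𝔞) :
    Submodule ℝ 𝔤 where
  carrier := {x : 𝔤 | ∀ a : ↥𝔞, ⁅(a : 𝔤), x⁆ = β a • x}
  add_mem' := by
    intro x y hx hy a
    rw [lie_add, hx a, hy a, smul_add]
  zero_mem' := by
    intro a
    rw [lie_zero, smul_zero]
  smul_mem' := by
    intro c x hx a
    rw [lie_smul, hx a]
    exact smul_comm c (β a) x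

/-- The set of restricted roots of `𝔤` relative to `𝔞`: the nonzero functionals `β` on `𝔞`
with `𝔤_β ≠ {0}`. -/
def restrictedRoots (𝔞 : LieSubalgebra ℝ 𝔤) : Set (Module.Dual ℝ ↥𝔞) :=
  {β | β ≠ 0 ∧ restrictedRootSpace 𝔞 β ≠ ⊥}

/-- `𝔞` is a maximal abelian subalgebra of `𝔤` all of whose elements act on `𝔤` by
`ℝ`-diagonalizable operators. -/
def IsMaximalRDiagonalizable (𝔞 : LieSubalgebra ℝ 𝔤) : Prop :=
  IsLieAbelian ↥𝔞 ∧
  (∀ a ∈ 𝔞, (⨆ μ : ℝ, Module.End.eigenspace (LieAlgebra.ad ℝ 𝔤 a) μ) = ⊤) ∧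
  ∀ 𝔟 : LieSubalgebra ℝ 𝔤, IsLieAbelian ↥𝔟 →
    (∀ a ∈ 𝔟, (⨆ μ : ℝ, Module.End.eigenspace (LieAlgebra.ad ℝ 𝔤 a) μ) = ⊤) →
    𝔞 ≤ 𝔟 → 𝔟 = 𝔞

section Commutators

variable {A : Type*} [Ring A]

theorem pow_succ_mul_eq_of_commute {X Z D : A} (hD : X * Z - Z * X = D) (hXD : Commute X D)
    (m : ℕ) : X ^ (m + 1) * Z = Z * X ^ (m + 1) + (m + 1 : A) * (D * X ^ m) := by
  have hD' : X * Z = Z * X + D := by rw [← hD]; abel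
  induction m with
  | zero => simp [hD']
  | succ m ih =>
    have h1 : X * (m + 1 : A) = (m + 1 : A) * X := by
      exact_mod_cast (Nat.cast_commute (m + 1) X).eq.symm
    calc X ^ (m + 1 + 1) * Z = X * (X ^ (m + 1) * Z) := by rw [pow_succ' X (m + 1), mul_assoc]
      _ = X * Z * X ^ (m + 1) + (X * (m + 1 : A)) * D * X ^ m := by rw [ih]; noncomm_ring
      _ = Z * (X * X ^ (m + 1)) + D * X ^ (m + 1) + (m + 1 : A) * ((X * D) * X ^ m) := by
        rw [h1, hD']; noncomm_ring
      _ = _ := by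
        rw [hXD.eq, mul_assoc D X, ← pow_succ' X m, ← pow_succ' X (m + 1)]
        push_cast
        noncomm_ring

theorem isNilpotent_of_commute_commutator [Algebra ℚ A] {X Z D : A} (hX : IsNilpotent X)
    (hD : X * Z - Z * X = D) (hXD : Commute X D) : IsNilpotent D := by
  obtain ⟨n, hn⟩ := hX
  suffices h : ∀ k ≤ n, ∃ a : ℕ, D ^ a * X ^ (n - k) = 0 by
    obtain ⟨a, ha⟩ := h n le_rfl
    exact ⟨a, by simpa using ha⟩
  intro k
  induction k with
  | zero => exact fun _ => ⟨0, by simpa using hn⟩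
  | succ k ih =>
    intro hk
    obtain ⟨a, ha⟩ := ih (by omega)
    obtain ⟨m, hm⟩ : ∃ m, n - k = m + 1 := ⟨n - k - 1, by omega⟩
    have hm' : n - (k + 1) = m := by omega
    rw [hm] at ha
    refine ⟨a + (1 + a), ?_⟩
    rw [hm']
    have hc : X ^ (m + 1) * D ^ a = 0 := by rw [(hXD.pow_pow _ _).eq, ha]
    have hkey := congrArg (fun t => D ^ a * t * D ^ a) (pow_succ_mul_eq_of_commute hD hXD m)
    simp only [mul_add, add_mul] at hkey
    have e1 : D ^ a * (X ^ (m + 1) * Z) * D ^ a = 0 := by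
      rw [← mul_assoc (D ^ a), ha]; simp
    have e2 : D ^ a * (Z * X ^ (m + 1)) * D ^ a = 0 := by
      rw [mul_assoc, mul_assoc Z, hc]; simp
    have hcast : D ^ a * (m + 1 : A) = (m + 1 : A) * D ^ a := by
      exact_mod_cast (Nat.cast_commute (m + 1) (D ^ a)).eq.symm
    have e3 : (m + 1 : A) * (D ^ (a + (1 + a)) * X ^ m) = 0 := by
      rw [pow_add D a, pow_add D 1, pow_one, mul_assoc, mul_assoc D, ← (hXD.pow_pow m a).eq,
        ← mul_assoc, ← hcast]
      rw [e1, e2] at hkey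
      simp only [zero_add, mul_add, add_mul, mul_one, one_mul, mul_assoc] at hkey ⊢
      exact hkey.symm
    have hu : IsUnit (m + 1 : A) := by
      have h : IsUnit ((m + 1 : ℕ) : ℚ) := (Nat.cast_ne_zero.mpr (Nat.succ_ne_zero m)).isUnit
      simpa using h.map (algebraMap ℚ A)
    exact hu.mul_right_eq_zero.mp e3

theorem mul_pow_of_commutator {X H : A} (hHX : H * X - X * H = 2 * X) (n : ℕ) :
    H * X ^ n = X ^ n * (H + 2 * n) := by
  have h' : H * X = X * H + 2 * X := by rw [← hHX]; abel
  induction n with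
  | zero => simp
  | succ n ih =>
    have hn : (n : A) * X = X * n := (Nat.cast_commute n X).eq
    calc H * X ^ (n + 1) = X ^ n * (H * X + 2 * (n * X)) := by
          rw [pow_succ, ← mul_assoc, ih]; noncomm_ring
      _ = _ := by rw [hn, h', pow_succ]; push_cast; noncomm_ring

theorem pow_succ_mul_of_commutator {X Y H : A} (hXY : X * Y - Y * X = H)
    (hHX : H * X - X * H = 2 * X) (n : ℕ) :
    X ^ (n + 1) * Y = Y * X ^ (n + 1) + (n + 1 : A) * ((H - n) * X ^ n) := by
  have h' : X * Y = Y * X + H := by rw [← hXY]; abel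
  have hXH : X * H = H * X - 2 * X := by rw [← hHX]; abel
  induction n with
  | zero => simp [h']
  | succ n ih =>
    have hn : X * (n : A) = n * X := (Nat.cast_commute n X).eq.symm
    have hn1 : X * (n + 1 : A) = (n + 1 : A) * X := by rw [mul_add, hn]; noncomm_ring
    calc X ^ (n + 1 + 1) * Y = X * (X ^ (n + 1) * Y) := by rw [pow_succ' X (n + 1), mul_assoc]
      _ = (X * Y) * X ^ (n + 1) + X * (n + 1 : A) * ((H - n) * X ^ n) := by
        rw [ih, mul_add, ← mul_assoc, ← mul_assoc]
      _ = Y * X * X ^ (n + 1) + H * X ^ (n + 1)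
            + (n + 1 : A) * ((X * H - X * (n : A)) * X ^ n) := by
        rw [h', hn1]; noncomm_ring
      _ = Y * (X * X ^ (n + 1)) + H * X ^ (n + 1)
            + (n + 1 : A) * ((H - 2 - n) * (X * X ^ n)) := by
        rw [hXH, hn]; noncomm_ring
      _ = _ := by
        rw [← pow_succ' X n, ← pow_succ' X (n + 1)]
        have hn' : (n : A) * H = H * n := (Nat.cast_commute n H).eq
        push_cast
        generalize X ^ (n + 1) = P
        simp only [mul_add, add_mul, mul_sub, sub_mul, ← mul_assoc, hn', one_mul, two_mul]
        noncomm_ring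

end Commutators

section EndLemmas

open Module

variable {K V : Type*} [Field K] [CharZero K] [AddCommGroup V] [Module K V]

theorem isNilpotent_mul_of_commute_commutator {X Z D : End K V} (hX : IsNilpotent X)
    (hD : X * Z - Z * X = D) (hXD : Commute X D) : IsNilpotent (X * Z) := by
  obtain ⟨N, hN⟩ : IsNilpotent D := by
    let _ : Algebra ℚ (End K V) := Algebra.compHom _ (algebraMap ℚ K)
    exact isNilpotent_of_commute_commutator hX hD hXD
  obtain ⟨n, hn⟩ := hX
  have hcomm (m : ℕ) (v : V) :
      (X ^ (m + 1)) (Z v) = Z ((X ^ (m + 1)) v) + (m + 1 : K) • D ((X ^ m) v) := by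
    have h := LinearMap.congr_fun (pow_succ_mul_eq_of_commute hD hXD m) v
    simpa [add_mul, add_smul, ← Nat.cast_smul_eq_nsmul K] using h
  have hstep (m : ℕ) (v : V) (hv : (X ^ (m + 1)) v = 0) (k : ℕ) :
      (X ^ (m + 1)) (((X * Z) ^ k) v) = 0 ∧
        (X ^ m) (((X * Z) ^ k) v) = (m + 1 : K) ^ k • (D ^ k) ((X ^ m) v) := by
    induction k with
    | zero => simpa using hv
    | succ k ih =>
      have key : (X ^ m) (((X * Z) ^ (k + 1)) v)
          = (m + 1 : K) ^ (k + 1) • (D ^ (k + 1)) ((X ^ m) v) := by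
        rw [pow_succ' (X * Z), End.mul_apply, End.mul_apply, ← End.mul_apply, ← pow_succ,
          hcomm, ih.1, ih.2, map_zero, zero_add, map_smul, smul_smul, pow_succ' D,
          End.mul_apply, ← pow_succ']
      refine ⟨?_, key⟩
      have hXm : X ((X ^ m) v) = 0 := by rw [← End.mul_apply, ← pow_succ', hv]
      rw [pow_succ' X, End.mul_apply, key, map_smul, ← End.mul_apply,
        (hXD.pow_right (k + 1)).eq, End.mul_apply, hXm, map_zero, smul_zero]
  suffices h : ∀ m : ℕ, ∃ k : ℕ, ∀ v, (X ^ m) v = 0 → ((X * Z) ^ k) v = 0 by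
    obtain ⟨k, hk⟩ := h n
    exact ⟨k, LinearMap.ext fun v => hk v (by simp [hn])⟩
  intro m
  induction m with
  | zero => exact ⟨0, fun v hv => by simpa using hv⟩
  | succ m ih =>
    obtain ⟨k, hk⟩ := ih
    refine ⟨k + N, fun v hv => ?_⟩
    rw [pow_add, End.mul_apply]
    exact hk _ (by rw [(hstep m v hv N).2, hN]; simp)

theorem exists_pow_succ_eq_of_commutator {X Y H : End K V} (hXY : X * Y - Y * X = H)
    (hHX : H * X - X * H = 2 * X) (n : ℕ) {w : V} (hw : X ((X ^ n) w) = 0) :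
    ∃ w', H ((X ^ n) w) - (n : K) • (X ^ n) w = (X ^ (n + 1)) w' := by
  have h := LinearMap.congr_fun (pow_succ_mul_of_commutator hXY hHX n) w
  have h0 : (X ^ (n + 1)) w = 0 := by rw [pow_succ']; exact hw
  refine ⟨(n + 1 : K)⁻¹ • Y w, ?_⟩
  have hne : (n + 1 : K) ≠ 0 := by exact_mod_cast Nat.succ_ne_zero n
  rw [map_smul, eq_inv_smul_iff₀ hne, ← End.mul_apply _ Y, h]
  simp [h0, add_mul, add_smul, ← Nat.cast_smul_eq_nsmul K]

/-- The eigenvalues of `H` on `ker X` are natural numbers. -/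
theorem exists_nat_eq_of_apply_eq_smul {X Y H : End K V} (hX : IsNilpotent X)
    (hXY : X * Y - Y * X = H) (hHX : H * X - X * H = 2 * X) {μ : K} {z : V} (hz : z ≠ 0)
    (hXz : X z = 0) (hHz : H z = μ • z) : ∃ i : ℕ, μ = i := by
  obtain ⟨N, hN⟩ := hX
  by_contra! hμ
  have h (n : ℕ) : ∃ w, z = (X ^ n) w := by
    induction n with
    | zero => exact ⟨z, by simp⟩
    | succ n ih =>
      obtain ⟨w, rfl⟩ := ih
      obtain ⟨w', hw'⟩ := exists_pow_succ_eq_of_commutator hXY hHX n hXz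
      refine ⟨(μ - n)⁻¹ • w', ?_⟩
      rw [hHz, ← sub_smul] at hw'
      rw [map_smul, ← hw', inv_smul_smul₀ (sub_ne_zero.mpr (hμ n))]
  obtain ⟨w, hw⟩ := h N
  exact hz (by simp [hw, hN])

theorem ker_inf_range_pow_le_iSup_eigenspace {X Y H : End K V} (hX : IsNilpotent X)
    (hXY : X * Y - Y * X = H) (hHX : H * X - X * H = 2 * X) (n : ℕ) :
    LinearMap.ker X ⊓ LinearMap.range (X ^ n) ≤
      ⨆ i : {i : ℕ // n ≤ i}, LinearMap.ker X ⊓ H.eigenspace (i : K) := by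
  obtain ⟨N, hN⟩ := hX
  induction hk : N - n generalizing n with
  | zero =>
    have : X ^ n = 0 := pow_eq_zero_of_le (by omega) hN
    simp [this]
  | succ k ih =>
    rintro _ ⟨hz, w, rfl⟩
    replace hz : X ((X ^ n) w) = 0 := hz
    obtain ⟨w', hw'⟩ := exists_pow_succ_eq_of_commutator hXY hHX n hz
    set z := (X ^ n) w
    have hXH : X (H z) = 0 := by
      have h := LinearMap.congr_fun hHX z
      simp only [LinearMap.sub_apply, End.mul_apply, hz, map_zero, zero_sub] at h
      simpa [hz, two_mul] using h
    have hmem : H z - (n : K) • z ∈ LinearMap.ker X ⊓ LinearMap.range (X ^ (n + 1)) :=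
      ⟨by simp [hXH, hz], w', hw'.symm⟩
    have hmem' := ih (n + 1) (by omega) hmem
    have hle : (⨆ i : {i : ℕ // n + 1 ≤ i}, LinearMap.ker X ⊓ H.eigenspace (i : K)) ≤
        Submodule.map (H - algebraMap K (End K V) n)
          (⨆ i : {i : ℕ // n + 1 ≤ i}, LinearMap.ker X ⊓ H.eigenspace (i : K)) := by
      refine iSup_le fun i u hu => ?_
      have hi : ((i : ℕ) : K) - n ≠ 0 := by
        rw [sub_ne_zero, Ne, Nat.cast_inj]
        have := i.2
        omega
      refine ⟨((i : ℕ) - n : K)⁻¹ • u, Submodule.smul_mem _ _ (Submodule.mem_iSup_of_mem i hu), ?_⟩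
      rw [map_smul, inv_smul_eq_iff₀ hi]
      have := End.mem_eigenspace_iff.mp hu.2
      simp [this, sub_smul, ← Nat.cast_smul_eq_nsmul K]
    obtain ⟨u, hu, hu'⟩ := hle hmem'
    have hmono : (⨆ i : {i : ℕ // n + 1 ≤ i}, LinearMap.ker X ⊓ H.eigenspace (i : K)) ≤
        ⨆ i : {i : ℕ // n ≤ i}, LinearMap.ker X ⊓ H.eigenspace (i : K) :=
      iSup_le fun i => le_iSup_of_le ⟨i.1, by have := i.2; omega⟩ le_rfl
    have hker : (⨆ i : {i : ℕ // n + 1 ≤ i}, LinearMap.ker X ⊓ H.eigenspace (i : K)) ≤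
        LinearMap.ker X := iSup_le fun i => inf_le_left
    have hzu : z - u ∈ LinearMap.ker X ⊓ H.eigenspace (n : K) := by
      refine ⟨Submodule.sub_mem _ hz (hker hu), End.mem_eigenspace_iff.mpr ?_⟩
      simp only [LinearMap.sub_apply, Module.algebraMap_end_apply] at hu'
      rw [map_sub, smul_sub, sub_eq_sub_iff_sub_eq_sub, ← hu']
    have h1 : z - u ∈ ⨆ i : {i : ℕ // n ≤ i}, LinearMap.ker X ⊓ H.eigenspace (i : K) :=
      Submodule.mem_iSup_of_mem (p := fun i : {i : ℕ // n ≤ i} =>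
        LinearMap.ker X ⊓ H.eigenspace (i : K)) ⟨n, le_rfl⟩ hzu
    simpa using Submodule.add_mem _ h1 (hmono hu)

theorem exists_pow_pow_apply_eq_smul {X Y H : End K V} (hXY : X * Y - Y * X = H)
    (hHY : H * Y - Y * H = -(2 * Y)) {i : ℕ} {u : V} (hXu : X u = 0) (hHu : H u = (i : K) • u)
    {n : ℕ} (hn : n ≤ i) : ∃ c : K, c ≠ 0 ∧ (X ^ n) ((Y ^ n) u) = c • u := by
  induction n with
  | zero => exact ⟨1, one_ne_zero, by simp⟩
  | succ n ih =>
    obtain ⟨c, hc, h⟩ := ih (by omega)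
    have hYX : Y * X - X * Y = -H := by rw [← hXY]; abel
    have hHY' : -H * Y - Y * -H = 2 * Y := by rw [← neg_inj, ← hHY]; noncomm_ring
    have h1 := LinearMap.congr_fun (pow_succ_mul_of_commutator hYX hHY' n) u
    have h2 := LinearMap.congr_fun (mul_pow_of_commutator hHY' n) u
    have h3 : H ((Y ^ n) u) = ((i : K) - 2 * n) • (Y ^ n) u := by
      simp [hHu, two_mul, ← Nat.cast_smul_eq_nsmul K] at h2
      rw [neg_eq_iff_eq_neg] at h2
      rw [h2]
      module
    have h4 : X ((Y ^ (n + 1)) u) = ((n + 1 : K) * (i - n)) • (Y ^ n) u := by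
      simp [hXu, h3, add_mul, ← Nat.cast_smul_eq_nsmul K] at h1
      rw [eq_neg_of_add_eq_zero_left h1.symm]
      module
    refine ⟨((n + 1 : K) * (i - n)) * c, mul_ne_zero (mul_ne_zero ?_ ?_) hc, ?_⟩
    · exact_mod_cast Nat.succ_ne_zero n
    · rw [sub_ne_zero, Ne, Nat.cast_inj]; omega
    · rw [pow_succ X, End.mul_apply, h4, map_smul, h, smul_smul]

/-- In a representation of an `𝔰𝔩₂`-triple with nilpotent `X`, the operator `H` is
diagonalizable. -/
theorem iSup_eigenspace_eq_top_of_commutator {X Y H : End K V} (hX : IsNilpotent X)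
    (hXY : X * Y - Y * X = H) (hHX : H * X - X * H = 2 * X) (hHY : H * Y - Y * H = -(2 * Y)) :
    ⨆ μ : K, H.eigenspace μ = ⊤ := by
  have hYmem (n : ℕ) {μ : K} {u : V} (hu : H u = μ • u) :
      (Y ^ n) u ∈ ⨆ μ : K, H.eigenspace μ := by
    have hHY' : -H * Y - Y * -H = 2 * Y := by rw [← neg_inj, ← hHY]; noncomm_ring
    have h2 := LinearMap.congr_fun (mul_pow_of_commutator hHY' n) u
    refine Submodule.mem_iSup_of_mem (μ - 2 * n) (End.mem_eigenspace_iff.mpr ?_)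
    simp [hu, two_mul, ← Nat.cast_smul_eq_nsmul K] at h2
    rw [neg_eq_iff_eq_neg] at h2
    rw [h2]
    module
  have h (n : ℕ) : LinearMap.ker (X ^ n) ≤ ⨆ μ : K, H.eigenspace μ := by
    induction n with
    | zero =>
      intro v hv
      have hv0 : v = 0 := by simpa using hv
      simp [hv0]
    | succ n ih =>
      intro v hv
      replace hv : X ((X ^ n) v) = 0 := by rw [← End.mul_apply, ← pow_succ']; exact hv
      have hle : (⨆ i : {i : ℕ // n ≤ i}, LinearMap.ker X ⊓ H.eigenspace (i : K)) ≤
          Submodule.map (X ^ n) (⨆ μ : K, H.eigenspace μ) := by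
        refine iSup_le fun i u hu => ?_
        have hHu := End.mem_eigenspace_iff.mp hu.2
        obtain ⟨c, hc, hcu⟩ := exists_pow_pow_apply_eq_smul hXY hHY hu.1 hHu i.2
        exact ⟨c⁻¹ • (Y ^ n) u, Submodule.smul_mem _ _ (hYmem n hHu), by
          rw [map_smul, hcu, inv_smul_smul₀ hc]⟩
      obtain ⟨w, hw, hwv⟩ :=
        hle (ker_inf_range_pow_le_iSup_eigenspace hX hXY hHX n ⟨hv, v, rfl⟩)
      have hvw : v - w ∈ LinearMap.ker (X ^ n) := by simp [hwv]
      simpa using Submodule.add_mem _ (ih hvw) hw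
  obtain ⟨N, hN⟩ := hX
  rw [eq_top_iff]
  exact fun v _ => h N (by simp [hN])

/-- If `[X, Y] = H` and `[H, X] = 2X` with `X` nilpotent, then every eigenvector of `H` whose
eigenvalue is not of the form `-n` for a natural number `n` lies in the range of `X`. -/
theorem mem_range_of_apply_eq_smul {X Y H : End K V} (hX : IsNilpotent X)
    (hXY : X * Y - Y * X = H) (hHX : H * X - X * H = 2 * X) {μ : K} {z : V}
    (hHz : H z = μ • z) (hμ : ∀ n : ℕ, μ + n ≠ 0) : z ∈ LinearMap.range X := by
  have hstep (n : ℕ) (v : V) (hv : (X ^ (n + 1)) v = 0) :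
      ∃ u, (X ^ n) (H v + (n : K) • v - X u) = 0 := by
    have h := LinearMap.congr_fun (pow_succ_mul_of_commutator hXY hHX n) v
    have h2 := LinearMap.congr_fun (mul_pow_of_commutator hHX n) v
    have hne : (n + 1 : K) ≠ 0 := by exact_mod_cast Nat.succ_ne_zero n
    refine ⟨(n + 1 : K)⁻¹ • Y v, ?_⟩
    have h3 : H ((X ^ n) v) = (X ^ n) (H v) + (2 * n : K) • (X ^ n) v := by
      simp [two_mul, ← Nat.cast_smul_eq_nsmul K] at h2
      rw [h2]
      module
    have h4 : (X ^ (n + 1)) (Y v) = (n + 1 : K) • ((X ^ n) (H v) + (n : K) • (X ^ n) v) := by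
      simp [hv, h3, add_mul, ← Nat.cast_smul_eq_nsmul K] at h
      rw [h]
      module
    rw [map_sub, map_smul, map_smul, ← End.mul_apply, ← pow_succ, h4, inv_smul_smul₀ hne,
      map_add, map_smul, sub_self]
  have hHr (w : V) : H (X w) ∈ LinearMap.range X := by
    have h := LinearMap.congr_fun hHX w
    refine ⟨H w + (2 : K) • w, ?_⟩
    simp only [LinearMap.sub_apply, End.mul_apply, sub_eq_iff_eq_add] at h
    rw [h, map_add, map_smul, add_comm]
    simp [two_smul]
  obtain ⟨N, hN⟩ := hX
  suffices h : ∀ n : ℕ, (∃ w, (X ^ n) (z - X w) = 0) → z ∈ LinearMap.range X from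
    h N ⟨0, by simp [hN]⟩
  intro n
  induction n with
  | zero =>
    rintro ⟨w, hw⟩
    exact ⟨w, (sub_eq_zero.mp (by simpa using hw)).symm⟩
  | succ n ih =>
    rintro ⟨w, hw⟩
    obtain ⟨u, hu⟩ := hstep n _ hw
    obtain ⟨w', hw'⟩ := hHr w
    refine ih ⟨(μ + n : K)⁻¹ • (w' + (n : K) • w + u), ?_⟩
    have : z - X ((μ + n : K)⁻¹ • (w' + (n : K) • w + u)) =
        (μ + n : K)⁻¹ • (H (z - X w) + (n : K) • (z - X w) - X u) := by
      rw [eq_inv_smul_iff₀ (hμ n), smul_sub, map_smul, smul_inv_smul₀ (hμ n), map_sub, hHz,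
        ← hw']
      simp only [map_add, map_smul]
      module
    rw [this, map_smul, hu, smul_zero]

end EndLemmas

section Diagonalizable

open Module

variable {K V : Type*} [Field K] [AddCommGroup V] [Module K V]

theorem iSup_eigenspace_smul_eq_top {f : End K V} (hf : ⨆ μ : K, f.eigenspace μ = ⊤) (c : K) :
    ⨆ μ : K, (c • f).eigenspace μ = ⊤ := by
  rw [eq_top_iff, ← hf]
  refine iSup_le fun μ => le_iSup_of_le (c * μ) fun v hv => ?_
  rw [End.mem_eigenspace_iff, LinearMap.smul_apply, End.mem_eigenspace_iff.mp hv, smul_smul]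

variable [FiniteDimensional K V]

theorem isNilpotent_of_commutator_eq_smul [CharZero K] {T X : End K V} {c : K} (hc : c ≠ 0)
    (h : T * X - X * T = c • X) : IsNilpotent X := by
  by_contra hX
  have hpow (n : ℕ) : X ^ n ≠ 0 := fun hn => hX ⟨n, hn⟩
  let L : End K (End K V) := LinearMap.mulLeft K T - LinearMap.mulRight K T
  have hL (n : ℕ) : L (X ^ n) = ((n : K) * c) • X ^ n := by
    have h' : T * X = X * T + c • X := by rw [← h]; abel
    change T * X ^ n - X ^ n * T = _
    induction n with
    | zero => simp
    | succ n ih =>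
      rw [sub_eq_iff_eq_add] at ih ⊢
      rw [pow_succ, ← mul_assoc, ih, add_mul, mul_assoc _ T, h', mul_add, smul_mul_assoc,
        mul_smul_comm, ← mul_assoc]
      push_cast
      module
  have hinj : Function.Injective fun n : ℕ => (n : K) * c := fun m n hmn => by
    simpa [hc] using hmn
  refine Set.infinite_range_of_injective hinj (L.finite_hasEigenvalue.subset ?_)
  rintro _ ⟨n, rfl⟩
  exact End.hasEigenvalue_of_hasEigenvector ⟨End.mem_eigenspace_iff.mpr (hL n), hpow n⟩

theorem maxGenEigenspace_eq_eigenspace_of_iSup_eq_top {f : End K V}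
    (hf : ⨆ μ : K, f.eigenspace μ = ⊤) (μ : K) : f.maxGenEigenspace μ = f.eigenspace μ := by
  refine le_antisymm ?_ ((f.genEigenspace μ).mono le_top)
  have h := Submodule.eq_iSup_inf_genEigenspace (p := f.maxGenEigenspace μ) (f := f) 1
    (End.mapsTo_maxGenEigenspace_of_comm (Commute.refl f) μ) hf
  rw [h]
  refine iSup_le fun ν => ?_
  rcases eq_or_ne ν μ with rfl | hν
  · exact inf_le_right
  · have hd : Disjoint (f.maxGenEigenspace μ) (f.genEigenspace ν 1) :=
      f.disjoint_genEigenspace hν.symm _ _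
    rw [hd.eq_bot]
    exact bot_le

theorem iSup_eigenspace_add_eq_top {f g : End K V} (hfg : Commute f g)
    (hf : ⨆ μ : K, f.eigenspace μ = ⊤) (hg : ⨆ μ : K, g.eigenspace μ = ⊤) :
    ⨆ μ : K, (f + g).eigenspace μ = ⊤ := by
  rw [eq_top_iff, ← hg]
  refine iSup_le fun μ => ?_
  rw [Submodule.eq_iSup_inf_genEigenspace (p := g.eigenspace μ) (f := f) 1
    (End.mapsTo_genEigenspace_of_comm hfg.symm μ 1) hf]
  refine iSup_le fun ν => le_iSup_of_le (ν + μ) fun v hv => ?_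
  have h1 := End.mem_eigenspace_iff.mp hv.1
  have h2 := End.mem_eigenspace_iff.mp hv.2
  rw [End.mem_eigenspace_iff, LinearMap.add_apply, h1, h2, add_smul]

end Diagonalizable

open Module in
theorem trace_mul_self_nonneg_of_iSup_eigenspace_eq_top {V : Type*} [AddCommGroup V]
    [Module ℝ V] [FiniteDimensional ℝ V] {f : End ℝ V} (hf : ⨆ μ : ℝ, f.eigenspace μ = ⊤) :
    0 ≤ LinearMap.trace ℝ V (f * f) := by
  classical
  have hint := DirectSum.isInternal_submodule_of_iSupIndep_of_iSup_eq_top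
    f.eigenspaces_iSupIndep hf
  have hfin := WellFoundedGT.finite_ne_bot_of_iSupIndep f.eigenspaces_iSupIndep
  have hmaps (μ : ℝ) : Set.MapsTo (f * f) (f.eigenspace μ) (f.eigenspace μ) :=
    End.mapsTo_genEigenspace_of_comm ((Commute.refl f).mul_right (Commute.refl f)) μ 1
  rw [LinearMap.trace_eq_sum_trace_restrict' hint hfin hmaps]
  refine Finset.sum_nonneg fun μ _ => ?_
  have h : (f * f).restrict (hmaps μ) = (μ * μ) • LinearMap.id := by
    ext ⟨v, hv⟩
    have := End.mem_eigenspace_iff.mp hv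
    change f (f v) = (μ * μ) • v
    rw [this, map_smul, this, smul_smul]
  rw [h, map_smul, LinearMap.trace_id, smul_eq_mul]
  exact mul_nonneg (mul_self_nonneg μ) (Nat.cast_nonneg _)

section RootSpaces

open Module LieAlgebra

theorem ad_commutator (x y : 𝔤) :
    ad ℝ 𝔤 x * ad ℝ 𝔤 y - ad ℝ 𝔤 y * ad ℝ 𝔤 x = ad ℝ 𝔤 ⁅x, y⁆ :=
  LinearMap.ext fun z => (lie_lie x y z).symm

theorem commute_ad_of_lie_eq_zero {x y : 𝔤} (h : ⁅x, y⁆ = 0) :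
    Commute (ad ℝ 𝔤 x) (ad ℝ 𝔤 y) := by
  rw [commute_iff_eq, ← sub_eq_zero, ad_commutator, h, map_zero]

theorem lie_mem_restrictedRootSpace {𝔞 : LieSubalgebra ℝ 𝔤} {β γ : Dual ℝ 𝔞} {x y : 𝔤}
    (hx : x ∈ restrictedRootSpace 𝔞 β) (hy : y ∈ restrictedRootSpace 𝔞 γ) :
    ⁅x, y⁆ ∈ restrictedRootSpace 𝔞 (β + γ) := by
  intro a
  rw [leibniz_lie, hx a, hy a, smul_lie, lie_smul, LinearMap.add_apply, add_smul]

theorem iSupIndep_restrictedRootSpace {𝔞 : LieSubalgebra ℝ 𝔤} (h𝔞 : IsLieAbelian 𝔞) :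
    iSupIndep (restrictedRootSpace 𝔞) := by
  have hcomm (a b : 𝔞) : Commute (ad ℝ 𝔤 (a : 𝔤)) (ad ℝ 𝔤 (b : 𝔤)) :=
    commute_ad_of_lie_eq_zero (congrArg Subtype.val (h𝔞.trivial a b))
  have h := End.independent_iInf_maxGenEigenspace_of_forall_mapsTo
    (fun a : 𝔞 => ad ℝ 𝔤 (a : 𝔤))
    (fun a b φ => End.mapsTo_maxGenEigenspace_of_comm (hcomm b a) φ)
  refine (h.comp (DFunLike.coe_injective : Function.Injective
    fun β : Dual ℝ 𝔞 => (β : 𝔞 → ℝ))).mono fun β x hx => ?_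
  simp only [Function.comp_apply, Submodule.mem_iInf]
  exact fun a => ((ad ℝ 𝔤 (a : 𝔤)).genEigenspace (β a)).mono le_top
    (End.mem_eigenspace_iff.mpr (hx a))

variable [FiniteDimensional ℝ 𝔤]

theorem iSup_restrictedRootSpace_eq_top {𝔞 : LieSubalgebra ℝ 𝔤} (h𝔞 : IsLieAbelian 𝔞)
    (hdiag : ∀ a ∈ 𝔞, ⨆ μ : ℝ, (ad ℝ 𝔤 a).eigenspace μ = ⊤) :
    ⨆ β, restrictedRootSpace 𝔞 β = ⊤ := by
  have hcomm (a b : 𝔞) : Commute (ad ℝ 𝔤 (a : 𝔤)) (ad ℝ 𝔤 (b : 𝔤)) :=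
    commute_ad_of_lie_eq_zero (congrArg Subtype.val (h𝔞.trivial a b))
  have hmax (a : 𝔞) (μ : ℝ) := maxGenEigenspace_eq_eigenspace_of_iSup_eq_top (hdiag a a.2) μ
  have h := End.iSup_iInf_maxGenEigenspace_eq_top_of_iSup_maxGenEigenspace_eq_top_of_commute
    (fun a : 𝔞 => ad ℝ 𝔤 (a : 𝔤)) (fun a b _ => hcomm a b)
    (fun a => by simp_rw [hmax]; exact hdiag a a.2)
  simp_rw [hmax] at h
  rw [eq_top_iff, ← h]
  refine iSup_le fun χ => ?_
  by_cases hbot : (⨅ a : 𝔞, (ad ℝ 𝔤 (a : 𝔤)).eigenspace (χ a)) = ⊥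
  · rw [hbot]; exact bot_le
  obtain ⟨v, hv, hv0⟩ := Submodule.exists_mem_ne_zero_of_ne_bot hbot
  have hχ {w : 𝔤} (hw : w ∈ ⨅ a : 𝔞, (ad ℝ 𝔤 (a : 𝔤)).eigenspace (χ a)) (a : 𝔞) :
      ⁅(a : 𝔤), w⁆ = χ a • w :=
    End.mem_eigenspace_iff.mp ((Submodule.mem_iInf _).mp hw a)
  let β : Dual ℝ 𝔞 :=
    { toFun := χ
      map_add' := fun a b => smul_left_injective ℝ hv0 (by
        change χ (a + b) • v = (χ a + χ b) • v
        rw [← hχ hv, add_smul, ← hχ hv, ← hχ hv, ← add_lie]; rfl)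
      map_smul' := fun c a => smul_left_injective ℝ hv0 (by
        change χ (c • a) • v = (c * χ a) • v
        rw [← hχ hv, mul_smul, ← hχ hv, ← smul_lie]; rfl) }
  exact le_iSup_of_le β fun w hw a => hχ hw a

/-- If `T` shifts the restricted root space grading by `c`, then every element of `𝔤_{γ + c}` in
the range of `T` has a preimage in `𝔤_γ`. -/
theorem exists_mem_restrictedRootSpace_apply_eq {𝔞 : LieSubalgebra ℝ 𝔤} (h𝔞 : IsLieAbelian 𝔞)
    (hdiag : ∀ a ∈ 𝔞, ⨆ μ : ℝ, (ad ℝ 𝔤 a).eigenspace μ = ⊤) {T : End ℝ 𝔤} {c : Dual ℝ 𝔞}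
    (hT : ∀ δ, ∀ v ∈ restrictedRootSpace 𝔞 δ, T v ∈ restrictedRootSpace 𝔞 (c + δ))
    {γ : Dual ℝ 𝔞} {z : 𝔤} (hz : z ∈ restrictedRootSpace 𝔞 (c + γ))
    (hzT : z ∈ LinearMap.range T) : ∃ w ∈ restrictedRootSpace 𝔞 γ, T w = z := by
  obtain ⟨w, rfl⟩ := hzT
  have hw : w ∈ ⨆ β, restrictedRootSpace 𝔞 β := by
    rw [iSup_restrictedRootSpace_eq_top h𝔞 hdiag]; trivial
  rw [iSup_split_single _ γ] at hw
  obtain ⟨w₁, hw₁, w₂, hw₂, rfl⟩ := Submodule.mem_sup.mp hw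
  refine ⟨w₁, hw₁, ?_⟩
  have h1 : T w₂ ∈ restrictedRootSpace 𝔞 (c + γ) := by
    have := Submodule.sub_mem _ hz (hT γ w₁ hw₁)
    simpa using this
  have h2 : T w₂ ∈ ⨆ δ, ⨆ (_ : δ ≠ c + γ), restrictedRootSpace 𝔞 δ := by
    have hle : (⨆ δ, ⨆ (_ : δ ≠ γ), restrictedRootSpace 𝔞 δ) ≤
        (⨆ δ, ⨆ (_ : δ ≠ c + γ), restrictedRootSpace 𝔞 δ).comap T :=
      iSup₂_le fun δ hδ v hv =>
        Submodule.mem_iSup_of_mem (c + δ) (Submodule.mem_iSup_of_mem (by simpa using hδ) (hT δ v hv))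
    exact hle hw₂
  have h0 := Submodule.disjoint_def.mp (iSupIndep_restrictedRootSpace h𝔞 (c + γ)) _ h1 h2
  rw [map_add, h0, add_zero]

theorem isNilpotent_ad_of_mem_restrictedRootSpace {𝔞 : LieSubalgebra ℝ 𝔤} {β : Dual ℝ 𝔞}
    (hβ : β ≠ 0) {x : 𝔤} (hx : x ∈ restrictedRootSpace 𝔞 β) : IsNilpotent (ad ℝ 𝔤 x) := by
  obtain ⟨a, ha⟩ : ∃ a, β a ≠ 0 := by
    by_contra! h
    exact hβ (LinearMap.ext h)
  refine isNilpotent_of_commutator_eq_smul (T := ad ℝ 𝔤 (a : 𝔤)) ha ?_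
  rw [ad_commutator, hx a, map_smul]

theorem mem_range_ad_sq_of_isNilpotent [IsKilling ℝ 𝔤] {x : 𝔤} (hx : IsNilpotent (ad ℝ 𝔤 x)) :
    x ∈ LinearMap.range (ad ℝ 𝔤 x ^ 2) := by
  by_contra hmem
  obtain ⟨φ, hφx, hφ⟩ := Submodule.exists_le_ker_of_notMem hmem
  let e := (killingForm ℝ 𝔤).toDual (IsKilling.killingForm_nondegenerate ℝ 𝔤)
  obtain ⟨v, rfl⟩ := e.surjective φ
  have he (w : 𝔤) : e v w = killingForm ℝ 𝔤 v w := LinearMap.BilinForm.toDual_def _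
  have hinv (a b : 𝔤) : killingForm ℝ 𝔤 a ⁅x, b⁆ = - killingForm ℝ 𝔤 ⁅x, a⁆ b := by
    rw [← lie_skew x a, map_neg, LinearMap.neg_apply, neg_neg]
    exact (LieModule.traceForm_apply_lie_apply ℝ 𝔤 𝔤 a x b).symm
  have hv : ⁅x, ⁅x, v⁆⁆ = 0 := by
    refine (IsKilling.killingForm_nondegenerate ℝ 𝔤).1 _ fun w => ?_
    have h : e v ((ad ℝ 𝔤 x ^ 2) w) = 0 := hφ ⟨w, rfl⟩
    rw [he, pow_two, End.mul_apply, ad_apply, ad_apply, hinv, hinv, neg_neg] at h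
    exact h
  refine hφx ?_
  rw [he, LieModule.traceForm_comm, killingForm_apply_apply]
  refine (LinearMap.isNilpotent_trace_of_isNilpotent
    (isNilpotent_mul_of_commute_commutator hx (ad_commutator x v)
      (commute_ad_of_lie_eq_zero hv))).eq_zero

/-- A graded version of the Jacobson–Morozov theorem. -/
theorem exists_sl2_of_mem_restrictedRootSpace [IsKilling ℝ 𝔤] {𝔞 : LieSubalgebra ℝ 𝔤}
    (h𝔞 : IsLieAbelian 𝔞) (hdiag : ∀ a ∈ 𝔞, ⨆ μ : ℝ, (ad ℝ 𝔤 a).eigenspace μ = ⊤)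
    {β : Dual ℝ 𝔞} (hβ : β ≠ 0) {x : 𝔤} (hx : x ∈ restrictedRootSpace 𝔞 β) :
    ∃ y ∈ restrictedRootSpace 𝔞 (-β), ⁅⁅x, y⁆, x⁆ = (2 : ℝ) • x ∧
      ⁅⁅x, y⁆, y⁆ = -((2 : ℝ) • y) := by
  have hnil := isNilpotent_ad_of_mem_restrictedRootSpace hβ hx
  obtain ⟨w, hw, hwx⟩ := exists_mem_restrictedRootSpace_apply_eq (T := ad ℝ 𝔤 x ^ 2)
    (c := β + β) (γ := -β) h𝔞 hdiag
    (fun δ v hv => by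
      rw [pow_two, add_assoc]
      exact lie_mem_restrictedRootSpace hx (lie_mem_restrictedRootSpace hx hv))
    (by simpa using hx) (mem_range_ad_sq_of_isNilpotent hnil)
  obtain ⟨y₀, hy₀⟩ : ∃ y₀, y₀ = -((2 : ℝ) • w) := ⟨_, rfl⟩
  have hy₀mem : y₀ ∈ restrictedRootSpace 𝔞 (-β) :=
    hy₀ ▸ Submodule.neg_mem _ (Submodule.smul_mem _ _ hw)
  obtain ⟨h, hh⟩ : ∃ h, h = ⁅x, y₀⁆ := ⟨_, rfl⟩
  have hh0 : h ∈ restrictedRootSpace 𝔞 0 := by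
    have := lie_mem_restrictedRootSpace hx hy₀mem
    rwa [add_neg_cancel, ← hh] at this
  have hhx : ⁅h, x⁆ = (2 : ℝ) • x := by
    have hwx' : ⁅x, ⁅x, w⁆⁆ = x := by simpa [pow_two] using hwx
    rw [← lie_skew, hh, hy₀, lie_neg, lie_neg, lie_smul, lie_smul, hwx', neg_neg]
  have hXY : ad ℝ 𝔤 x * ad ℝ 𝔤 y₀ - ad ℝ 𝔤 y₀ * ad ℝ 𝔤 x = ad ℝ 𝔤 h := by
    rw [ad_commutator, hh]
  have hHX : ad ℝ 𝔤 h * ad ℝ 𝔤 x - ad ℝ 𝔤 x * ad ℝ 𝔤 h = 2 * ad ℝ 𝔤 x := by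
    rw [ad_commutator, hhx, map_smul, two_smul, two_mul]
  let U : Submodule ℝ 𝔤 := LinearMap.ker (ad ℝ 𝔤 x) ⊓ restrictedRootSpace 𝔞 (-β)
  let T : End ℝ 𝔤 := ad ℝ 𝔤 h + (2 : ℝ) • LinearMap.id
  have hTU : ∀ v ∈ U, T v ∈ U := by
    rintro v ⟨hxv, hv⟩
    replace hxv : ⁅x, v⁆ = 0 := hxv
    refine Submodule.add_mem _ ⟨?_, ?_⟩ (Submodule.smul_mem _ _ ⟨hxv, hv⟩)
    · change ⁅x, ⁅h, v⁆⁆ = 0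
      rw [leibniz_lie, hxv, lie_zero, add_zero, ← lie_skew x h, hhx, neg_lie, smul_lie, hxv,
        smul_zero, neg_zero]
    · have := lie_mem_restrictedRootSpace hh0 hv
      rwa [zero_add] at this
  have hinj : Function.Injective (T.restrict hTU) := by
    rw [injective_iff_map_eq_zero]
    rintro ⟨v, hxv, hv⟩ hTv
    replace hTv : ⁅h, v⁆ + (2 : ℝ) • v = 0 := congrArg Subtype.val hTv
    by_contra hv0
    obtain ⟨i, hi⟩ := exists_nat_eq_of_apply_eq_smul (μ := (-2 : ℝ)) (z := v) hnil hXY hHX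
      (fun h0 => hv0 (Subtype.ext h0)) hxv
      (by rw [ad_apply, eq_neg_of_add_eq_zero_left hTv, neg_smul])
    have : (0 : ℝ) ≤ i := Nat.cast_nonneg i
    linarith
  have hd : T y₀ ∈ U := by
    refine ⟨?_, Submodule.add_mem _ ?_ (Submodule.smul_mem _ _ hy₀mem)⟩
    · change ⁅x, ⁅h, y₀⁆ + (2 : ℝ) • y₀⁆ = 0
      rw [lie_add, leibniz_lie, lie_smul, ← hh, lie_self, add_zero, ← lie_skew x h, hhx, neg_lie,
        smul_lie, ← hh, neg_add_cancel]
    · have := lie_mem_restrictedRootSpace hh0 hy₀mem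
      rwa [zero_add] at this
  obtain ⟨⟨e, hxe, he⟩, heT⟩ := LinearMap.injective_iff_surjective.mp hinj ⟨T y₀, hd⟩
  replace heT : T e = T y₀ := congrArg Subtype.val heT
  replace hxe : ⁅x, e⁆ = 0 := hxe
  have hxy : ⁅x, y₀ - e⁆ = h := by rw [lie_sub, hxe, sub_zero, hh]
  refine ⟨y₀ - e, Submodule.sub_mem _ hy₀mem he, by rw [hxy, hhx], ?_⟩
  have : T (y₀ - e) = 0 := by rw [map_sub, heT, sub_self]
  rw [hxy]
  exact eq_neg_of_add_eq_zero_left this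

/-- An element of the centralizer of `𝔞` acting diagonalizably on `𝔤` belongs to `𝔞`. -/
theorem mem_of_iSup_eigenspace_eq_top {𝔞 : LieSubalgebra ℝ 𝔤} (h𝔞 : IsMaximalRDiagonalizable 𝔞)
    {h : 𝔤} (hh : h ∈ restrictedRootSpace 𝔞 0)
    (hdiag : ⨆ μ : ℝ, (ad ℝ 𝔤 h).eigenspace μ = ⊤) : h ∈ 𝔞 := by
  have hah (a : 𝔤) (ha : a ∈ 𝔞) : ⁅a, h⁆ = 0 := by simpa using hh ⟨a, ha⟩
  have haa (a b : 𝔤) (ha : a ∈ 𝔞) (hb : b ∈ 𝔞) : ⁅a, b⁆ = 0 :=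
    congrArg Subtype.val (h𝔞.1.trivial (⟨a, ha⟩ : 𝔞) ⟨b, hb⟩)
  have hbr : ∀ u ∈ 𝔞.toSubmodule ⊔ Submodule.span ℝ {h},
      ∀ v ∈ 𝔞.toSubmodule ⊔ Submodule.span ℝ {h}, ⁅u, v⁆ = 0 := by
    intro u hu v hv
    obtain ⟨a, ha, u', hu', rfl⟩ := Submodule.mem_sup.mp hu
    obtain ⟨b, hb, v', hv', rfl⟩ := Submodule.mem_sup.mp hv
    obtain ⟨s, rfl⟩ := Submodule.mem_span_singleton.mp hu'
    obtain ⟨t, rfl⟩ := Submodule.mem_span_singleton.mp hv'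
    have hhb : ⁅h, b⁆ = 0 := by rw [← lie_skew, hah b hb, neg_zero]
    simp [haa a b ha hb, hah a ha, hhb]
  let 𝔟 : LieSubalgebra ℝ 𝔤 :=
    { 𝔞.toSubmodule ⊔ Submodule.span ℝ {h} with
      lie_mem' := fun {u v} hu hv => by
        rw [hbr u hu v hv]; exact Submodule.zero_mem _ }
  have h𝔟 : 𝔟 = 𝔞 := by
    refine h𝔞.2.2 𝔟 ⟨fun u v => Subtype.ext (hbr u u.2 v v.2)⟩ ?_ ?_
    · intro u hu
      obtain ⟨a, ha, u', hu', rfl⟩ := Submodule.mem_sup.mp hu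
      obtain ⟨s, rfl⟩ := Submodule.mem_span_singleton.mp hu'
      rw [map_add, map_smul]
      refine iSup_eigenspace_add_eq_top
        ((commute_ad_of_lie_eq_zero (hah a ha)).smul_right s) (h𝔞.2.1 a ha)
        (iSup_eigenspace_smul_eq_top hdiag s)
    · exact fun a ha => (le_sup_left : 𝔞.toSubmodule ≤ _ ⊔ Submodule.span ℝ {h}) ha
  rw [← h𝔟]
  exact (le_sup_right : Submodule.span ℝ {h} ≤ 𝔞.toSubmodule ⊔ _)
    (Submodule.mem_span_singleton_self h)

end RootSpaces

/-- **Lemma (root space surjectivity).**  Let `𝔤` be a finite-dimensional real semisimple Lie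
algebra, `𝔞` a maximal `ℝ`-diagonalizable subalgebra, `β ∈ Σ` and `γ ∈ Σ ∪ {0}` with
`⟨β, β + 2γ⟩ ≥ 0` (the inner product on `𝔞*` induced by the Killing form).  Then for every
nonzero `x ∈ 𝔤_β` one has `[x, 𝔤_γ] = 𝔤_{β+γ}`. -/
theorem ad_rootSpace_surjective
    [FiniteDimensional ℝ 𝔤] [LieAlgebra.IsSemisimple ℝ 𝔤]
    (𝔞 : LieSubalgebra ℝ 𝔤) (h𝔞 : IsMaximalRDiagonalizable 𝔞)
    (β γ : Module.Dual ℝ ↥𝔞)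
    (hβ : β ∈ restrictedRoots 𝔞)
    (hγ : γ ∈ restrictedRoots 𝔞 ∪ {0})
    -- `hb = h_β` and `hd = h_{β + 2γ}` are the elements of `𝔞` representing `β` and
    -- `β + 2γ` via the Killing form
    (hb hd : 𝔤) (hbmem : hb ∈ 𝔞) (hdmem : hd ∈ 𝔞)
    (hhb : ∀ a : ↥𝔞, killingForm ℝ 𝔤 hb (a : 𝔤) = β a)
    (hhd : ∀ a : ↥𝔞, killingForm ℝ 𝔤 hd (a : 𝔤) = (β + (2 : ℝ) • γ) a)
    -- `⟨β, β + 2γ⟩ ≥ 0`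
    (hpos : 0 ≤ killingForm ℝ 𝔤 hb hd)
    (x : 𝔤) (hx : x ∈ restrictedRootSpace 𝔞 β) (hx0 : x ≠ 0) :
    Submodule.map (LieAlgebra.ad ℝ 𝔤 x) (restrictedRootSpace 𝔞 γ) =
      restrictedRootSpace 𝔞 (β + γ) := by
  have h𝔞ab := h𝔞.1
  have hdiag := h𝔞.2.1
  obtain ⟨y, hy, hhx, hhy⟩ := exists_sl2_of_mem_restrictedRootSpace h𝔞ab hdiag hβ.1 hx
  obtain ⟨h, hh⟩ : ∃ h, h = ⁅x, y⁆ := ⟨_, rfl⟩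
  rw [← hh] at hhx hhy
  have hnil := isNilpotent_ad_of_mem_restrictedRootSpace hβ.1 hx
  have hXY : LieAlgebra.ad ℝ 𝔤 x * LieAlgebra.ad ℝ 𝔤 y - LieAlgebra.ad ℝ 𝔤 y * LieAlgebra.ad ℝ 𝔤 x
      = LieAlgebra.ad ℝ 𝔤 h := by rw [ad_commutator, hh]
  have hHX : LieAlgebra.ad ℝ 𝔤 h * LieAlgebra.ad ℝ 𝔤 x - LieAlgebra.ad ℝ 𝔤 x * LieAlgebra.ad ℝ 𝔤 h
      = 2 * LieAlgebra.ad ℝ 𝔤 x := by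
    rw [ad_commutator, hhx, map_smul, two_smul, two_mul]
  have hHY : LieAlgebra.ad ℝ 𝔤 h * LieAlgebra.ad ℝ 𝔤 y - LieAlgebra.ad ℝ 𝔤 y * LieAlgebra.ad ℝ 𝔤 h
      = -(2 * LieAlgebra.ad ℝ 𝔤 y) := by
    rw [ad_commutator, hhy, map_neg, map_smul, two_smul, two_mul]
  have hh0 : h ∈ restrictedRootSpace 𝔞 0 := by
    have := lie_mem_restrictedRootSpace hx hy
    rwa [add_neg_cancel, ← hh] at this
  have hmem : h ∈ 𝔞 := mem_of_iSup_eigenspace_eq_top h𝔞 hh0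
    (iSup_eigenspace_eq_top_of_commutator hnil hXY hHX hHY)
  have hβh : β ⟨h, hmem⟩ = 2 :=
    smul_left_injective ℝ hx0 ((hx ⟨h, hmem⟩).symm.trans hhx)
  -- `h` is the multiple `B(x, y) • h_β` of `h_β`
  have hkill (a : 𝔤) (ha : a ∈ 𝔞) :
      killingForm ℝ 𝔤 h a = killingForm ℝ 𝔤 x y * β ⟨a, ha⟩ := by
    have hya : ⁅y, a⁆ = β ⟨a, ha⟩ • y := by
      rw [← lie_skew, hy ⟨a, ha⟩, LinearMap.neg_apply, neg_smul, neg_neg]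
    rw [hh, LieModule.traceForm_apply_lie_apply, hya, map_smul, smul_eq_mul, mul_comm]
  have hb_nonneg : 0 ≤ killingForm ℝ 𝔤 hb hb := by
    rw [killingForm_apply_apply]
    exact trace_mul_self_nonneg_of_iSup_eigenspace_eq_top (hdiag hb hbmem)
  have h1 : killingForm ℝ 𝔤 x y * killingForm ℝ 𝔤 hb hb = 2 := by
    rw [← hβh, ← hhb ⟨h, hmem⟩, LieModule.traceForm_comm ℝ 𝔤 𝔤 hb h, hkill hb hbmem,
      ← hhb ⟨hb, hbmem⟩]
  have h2 : killingForm ℝ 𝔤 x y * killingForm ℝ 𝔤 hb hd = 2 + 2 * γ ⟨h, hmem⟩ := by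
    have := hhd ⟨h, hmem⟩
    rw [LieModule.traceForm_comm, hkill hd hdmem, ← hhb ⟨hd, hdmem⟩] at this
    simpa [hβh] using this
  have hxy : 0 < killingForm ℝ 𝔤 x y := by
    by_contra! hle
    have := mul_nonpos_of_nonpos_of_nonneg hle hb_nonneg
    linarith
  have hγh : 0 ≤ 2 + 2 * γ ⟨h, hmem⟩ := h2 ▸ mul_nonneg hxy.le hpos
  refine le_antisymm ?_ fun z hz => ?_
  · rintro _ ⟨w, hw, rfl⟩
    exact lie_mem_restrictedRootSpace hx hw
  · refine exists_mem_restrictedRootSpace_apply_eq h𝔞ab hdiag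
      (fun δ v hv => lie_mem_restrictedRootSpace hx hv) hz
      (mem_range_of_apply_eq_smul hnil hXY hHX (hz ⟨h, hmem⟩) fun n => ?_)
    have hn : (0 : ℝ) ≤ n := Nat.cast_nonneg n
    rw [LinearMap.add_apply, hβh]
    linarith
end

section
/- Let β ∈ Σ and let 𝔟₂ = ⨁_{γ ∈ Σ, γ ∉ ℝβ} 𝔤_γ be the sum of the restricted root spaces for roots not proportional to β. Then the Lie subalgebra ⟨𝔟₂⟩ of 𝔤 generated by 𝔟₂ is a Lie ideal of 𝔤. -/
variable {𝔤 : Type*} [LieRing 𝔤] [LieAlgebra ℝ 𝔤]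

/-- `𝔟₂ = ⨁_{γ ∈ Σ, γ ∉ ℝβ} 𝔤_γ`: the sum of the restricted root spaces for the roots that
are not real multiples of `β`. -/
def rootSpacesOffLine (𝔞 : LieSubalgebra ℝ 𝔤) (β : Module.Dual ℝ ↥𝔞) : Submodule ℝ 𝔤 :=
  ⨆ γ : Module.Dual ℝ ↥𝔞,
    ⨆ _ : γ ∈ restrictedRoots 𝔞 ∧ ∀ t : ℝ, γ ≠ t • β, restrictedRootSpace 𝔞 γ

theorem Module.End.maxGenEigenspace_eq_eigenspace_of_iSup_eigenspace_eq_top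
    {K V : Type*} [Field K] [AddCommGroup V] [Module K V] (f : Module.End K V)
    (hf : ⨆ μ, f.eigenspace μ = ⊤) (μ : K) :
    f.maxGenEigenspace μ = f.eigenspace μ :=
  (congr_fun ((f.independent_maxGenEigenspace.le_iff_eq_of_iSup_eq_top hf).mp
    fun _ ↦ (f.genEigenspace _).monotone le_top) μ).symm

theorem lie_mem_restrictedRootSpace_add (𝔞 : LieSubalgebra ℝ 𝔤) {γ δ : Module.Dual ℝ ↥𝔞}
    {x y : 𝔤} (hx : x ∈ restrictedRootSpace 𝔞 γ) (hy : y ∈ restrictedRootSpace 𝔞 δ) :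
    ⁅x, y⁆ ∈ restrictedRootSpace 𝔞 (γ + δ) := by
  intro a
  rw [leibniz_lie, hx a, hy a, smul_lie, lie_smul, LinearMap.add_apply, add_smul]

/-- A nonzero joint eigenvector of `𝔞` determines a linear functional on `𝔞`. -/
theorem exists_mem_restrictedRootSpace (𝔞 : LieSubalgebra ℝ 𝔤) (χ : ↥𝔞 → ℝ) {x : 𝔤}
    (hx : ∀ a : ↥𝔞, ⁅(a : 𝔤), x⁆ = χ a • x) :
    ∃ δ : Module.Dual ℝ ↥𝔞, x ∈ restrictedRootSpace 𝔞 δ := by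
  rcases eq_or_ne x 0 with rfl | h0
  · exact ⟨0, zero_mem _⟩
  · refine ⟨⟨⟨χ, fun a b ↦ smul_left_injective ℝ h0 ?_⟩, fun c a ↦ smul_left_injective ℝ h0 ?_⟩,
      hx⟩
    · simp only [add_smul, ← hx, ← add_lie]
      rfl
    · simp only [smul_eq_mul, RingHom.id_apply, mul_smul, ← hx, ← smul_lie]
      rfl

/-- The restricted root space decomposition: the joint eigenspaces of `𝔞` span `𝔤`. -/
theorem iSup_restrictedRootSpace_eq_top_s4 [FiniteDimensional ℝ 𝔤] (𝔞 : LieSubalgebra ℝ 𝔤)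
    [IsLieAbelian ↥𝔞]
    (h : ∀ a ∈ 𝔞, (⨆ μ : ℝ, Module.End.eigenspace (LieAlgebra.ad ℝ 𝔤 a) μ) = ⊤) :
    ⨆ δ : Module.Dual ℝ ↥𝔞, restrictedRootSpace 𝔞 δ = ⊤ := by
  let f : ↥𝔞 → Module.End ℝ 𝔤 := fun a ↦ LieAlgebra.ad ℝ 𝔤 (a : 𝔤)
  have hf (a : ↥𝔞) (μ : ℝ) : (f a).maxGenEigenspace μ = (f a).eigenspace μ :=
    Module.End.maxGenEigenspace_eq_eigenspace_of_iSup_eigenspace_eq_top _ (h a a.2) μ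
  have hcomm : Pairwise fun a b ↦ Commute (f a) (f b) := fun a b _ ↦ by
    have hab : ⁅(a : 𝔤), (b : 𝔤)⁆ = 0 := congrArg Subtype.val (trivial_lie_zero ↥𝔞 ↥𝔞 a b)
    refine LinearMap.ext fun x ↦ ?_
    change ⁅(a : 𝔤), ⁅(b : 𝔤), x⁆⁆ = ⁅(b : 𝔤), ⁅(a : 𝔤), x⁆⁆
    rw [leibniz_lie, hab, zero_lie, zero_add]
  have htop := Module.End.iSup_iInf_maxGenEigenspace_eq_top_of_iSup_maxGenEigenspace_eq_top_of_commute
    f hcomm fun a ↦ by simpa only [hf] using h a a.2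
  rw [eq_top_iff, ← htop]
  refine iSup_le fun χ x hx ↦ ?_
  obtain ⟨δ, hδ⟩ := exists_mem_restrictedRootSpace 𝔞 χ (x := x) fun a ↦ by
    have := (Submodule.mem_iInf _).mp hx a
    rwa [hf, Module.End.mem_eigenspace_iff] at this
  exact Submodule.mem_iSup_of_mem δ hδ

theorem restrictedRootSpace_le_rootSpacesOffLine (𝔞 : LieSubalgebra ℝ 𝔤)
    {β γ : Module.Dual ℝ ↥𝔞} (hγ : ∀ t : ℝ, γ ≠ t • β) :
    restrictedRootSpace 𝔞 γ ≤ rootSpacesOffLine 𝔞 β := by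
  by_cases hbot : restrictedRootSpace 𝔞 γ = ⊥
  · exact hbot ▸ bot_le
  · exact le_iSup₂_of_le γ ⟨⟨by simpa using hγ 0, hbot⟩, hγ⟩ le_rfl

theorem lie_mem_rootSpacesOffLine (𝔞 : LieSubalgebra ℝ 𝔤) {β : Module.Dual ℝ ↥𝔞} {t : ℝ}
    {x y : 𝔤} (hx : x ∈ restrictedRootSpace 𝔞 (t • β)) (hy : y ∈ rootSpacesOffLine 𝔞 β) :
    ⁅x, y⁆ ∈ rootSpacesOffLine 𝔞 β := by
  suffices rootSpacesOffLine 𝔞 β ≤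
      (rootSpacesOffLine 𝔞 β).comap (LieAlgebra.ad ℝ 𝔤 x : 𝔤 →ₗ[ℝ] 𝔤) from this hy
  refine iSup₂_le fun γ hγ z hz ↦ ?_
  refine restrictedRootSpace_le_rootSpacesOffLine 𝔞 (fun s hs ↦ hγ.2 (s - t) ?_)
    (lie_mem_restrictedRootSpace_add 𝔞 hx hz)
  exact (eq_sub_of_add_eq' hs).trans (sub_smul s t β).symm

theorem LieSubalgebra.mem_normalizer_lieSpan {R L : Type*} [CommRing R] [LieRing L]
    [LieAlgebra R L] {s : Set L} {x : L} (hx : ∀ y ∈ s, ⁅x, y⁆ ∈ lieSpan R L s) :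
    x ∈ (lieSpan R L s).normalizer := by
  rw [mem_normalizer_iff]
  intro y hy
  induction hy using lieSpan_induction with
  | mem y hy => exact hx y hy
  | zero => simp
  | add y z _ _ hy hz => rw [lie_add]; exact add_mem hy hz
  | smul c y _ hy => rw [lie_smul]; exact (lieSpan R L s).smul_mem c hy
  | lie y z hy' hz' hy hz =>
    rw [leibniz_lie]
    exact add_mem (lie_mem _ hy hz') (lie_mem _ hy' hz)

/-- **Lemma.**  Let `𝔤` be a finite-dimensional real semisimple Lie algebra, `𝔞` a maximal
`ℝ`-diagonalizable subalgebra, `β ∈ Σ`, and `𝔟₂ = ⨁_{γ ∈ Σ, γ ∉ ℝβ} 𝔤_γ`.  Then the Lie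
subalgebra `⟨𝔟₂⟩` generated by `𝔟₂` is a Lie ideal of `𝔤`. -/
theorem lieSpan_rootSpacesOffLine_isIdeal
    [FiniteDimensional ℝ 𝔤] [LieAlgebra.IsSemisimple ℝ 𝔤]
    (𝔞 : LieSubalgebra ℝ 𝔤) (h𝔞 : IsMaximalRDiagonalizable 𝔞)
    (β : Module.Dual ℝ ↥𝔞) (hβ : β ∈ restrictedRoots 𝔞) :
    ∀ x : 𝔤, ∀ y ∈ LieSubalgebra.lieSpan ℝ 𝔤 (rootSpacesOffLine 𝔞 β : Set 𝔤),
      ⁅x, y⁆ ∈ LieSubalgebra.lieSpan ℝ 𝔤 (rootSpacesOffLine 𝔞 β : Set 𝔤) := by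
  have := h𝔞.1
  suffices (⊤ : Submodule ℝ 𝔤) ≤ (LieSubalgebra.lieSpan ℝ 𝔤
      (rootSpacesOffLine 𝔞 β : Set 𝔤)).normalizer.toSubmodule from
    fun x ↦ (LieSubalgebra.mem_normalizer_iff _ x).mp (this trivial)
  rw [← iSup_restrictedRootSpace_eq_top_s4 𝔞 h𝔞.2.1]
  refine iSup_le fun δ x hx ↦ ?_
  by_cases hδ : ∃ t : ℝ, δ = t • β
  · obtain ⟨t, rfl⟩ := hδ
    exact LieSubalgebra.mem_normalizer_lieSpan fun y hy ↦
      LieSubalgebra.subset_lieSpan (lie_mem_rootSpacesOffLine 𝔞 hx hy)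
  · push Not at hδ
    exact LieSubalgebra.le_normalizer _
      (LieSubalgebra.subset_lieSpan (restrictedRootSpace_le_rootSpacesOffLine 𝔞 hδ hx))
end
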